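/- arXiv:2406.12241 — 4 statements merged into one kernel-verified Lean document; each statement's English description precedes it below -/
import Mathlib

section
/- Let X and Y be measurable spaces, let μ₁ and μ₂ be probability measures on X, and let κ₁ and κ₂ be Markov kernels from X to Y. If ε ≥ 0 satisfies TV(κ₁(x), κ₂(x)) ≤ ε for every x ∈ X, then the joint laws satisfy TV(μ₁ ⊗ₘ κ₁, μ₂ ⊗ₘ κ₂) ≤ TV(μ₁, μ₂) + ε. -/
open MeasureTheory ProbabilityTheory

/-- Total variation distance between two measures:
`TV(ρ, σ) = ⨆_{A measurable} |ρ(A) − σ(A)|`. -/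
noncomputable def tvDist {Ω : Type*} [MeasurableSpace Ω] (ρ σ : Measure Ω) : ℝ :=
  ⨆ A : {A : Set Ω // MeasurableSet A}, |(ρ A.1).toReal - (σ A.1).toReal|

theorem abs_toReal_sub_le_tvDist {Ω : Type*} [MeasurableSpace Ω] (μ ν : Measure Ω)
    [IsFiniteMeasure μ] [IsFiniteMeasure ν] {A : Set Ω} (hA : MeasurableSet A) :
    |(μ A).toReal - (ν A).toReal| ≤ tvDist μ ν := by
  refine le_ciSup (f := fun A : {A : Set Ω // MeasurableSet A} ↦
    |(μ A.1).toReal - (ν A.1).toReal|) ⟨μ.real Set.univ + ν.real Set.univ, ?_⟩ ⟨A, hA⟩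
  rintro _ ⟨B, rfl⟩
  have hμ : μ.real B.1 ≤ μ.real Set.univ := measureReal_mono (Set.subset_univ _)
  have hν : ν.real B.1 ≤ ν.real Set.univ := measureReal_mono (Set.subset_univ _)
  have hμ₀ : 0 ≤ μ.real B.1 := measureReal_nonneg
  have hν₀ : 0 ≤ ν.real B.1 := measureReal_nonneg
  change |μ.real B.1 - ν.real B.1| ≤ _
  rw [abs_le]
  constructor <;> linarith

theorem tvDist_comm {Ω : Type*} [MeasurableSpace Ω] (μ ν : Measure Ω) :
    tvDist μ ν = tvDist ν μ := by
  simp only [tvDist, abs_sub_comm]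

theorem integral_sub_integral_le_tvDist {Ω : Type*} [MeasurableSpace Ω] (μ ν : Measure Ω)
    [IsFiniteMeasure μ] [IsFiniteMeasure ν] {f : Ω → ℝ} (hf : Measurable f)
    (hf₀ : ∀ x, 0 ≤ f x) (hf₁ : ∀ x, f x ≤ 1) :
    ∫ x, f x ∂μ - ∫ x, f x ∂ν ≤ tvDist μ ν := by
  have hint (ρ : Measure Ω) [IsFiniteMeasure ρ] : Integrable f ρ :=
    Integrable.of_bound hf.aestronglyMeasurable 1
      (.of_forall fun x ↦ by rw [Real.norm_of_nonneg (hf₀ x)]; exact hf₁ x)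
  obtain ⟨s, hs⟩ := exists_isHahnDecomposition μ ν
  have hsm := hs.measurableSet
  have h_on : ∫ x in s, f x ∂μ ≤ ∫ x in s, f x ∂ν :=
    integral_mono_measure hs.le_on (.of_forall hf₀) (hint _)
  have h_compl : ∫ x in sᶜ, (1 - f x) ∂ν ≤ ∫ x in sᶜ, (1 - f x) ∂μ :=
    integral_mono_measure hs.ge_on_compl (.of_forall fun x ↦ sub_nonneg.2 (hf₁ x))
      ((integrable_const 1).sub (hint _))
  rw [integral_sub (integrable_const 1) (hint _), integral_sub (integrable_const 1) (hint _)]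
    at h_compl
  simp only [integral_const, measureReal_restrict_apply_univ, smul_eq_mul, mul_one] at h_compl
  have h_tv := (le_abs_self _).trans (abs_toReal_sub_le_tvDist μ ν hsm.compl)
  change μ.real sᶜ - ν.real sᶜ ≤ _ at h_tv
  rw [← integral_add_compl hsm (hint μ), ← integral_add_compl hsm (hint ν)]
  linarith

theorem abs_integral_sub_integral_le_tvDist {Ω : Type*} [MeasurableSpace Ω] (μ ν : Measure Ω)
    [IsFiniteMeasure μ] [IsFiniteMeasure ν] {f : Ω → ℝ} (hf : Measurable f)
    (hf₀ : ∀ x, 0 ≤ f x) (hf₁ : ∀ x, f x ≤ 1) :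
    |∫ x, f x ∂μ - ∫ x, f x ∂ν| ≤ tvDist μ ν := by
  refine abs_sub_le_iff.2 ⟨integral_sub_integral_le_tvDist μ ν hf hf₀ hf₁, ?_⟩
  rw [tvDist_comm]
  exact integral_sub_integral_le_tvDist ν μ hf hf₀ hf₁

theorem toReal_compProd_apply {X Y : Type*} [MeasurableSpace X] [MeasurableSpace Y]
    (μ : Measure X) [SFinite μ] (κ : Kernel X Y) [IsFiniteKernel κ]
    {C : Set (X × Y)} (hC : MeasurableSet C) :
    ((μ ⊗ₘ κ) C).toReal = ∫ x, (κ x (Prod.mk x ⁻¹' C)).toReal ∂μ := by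
  rw [Measure.compProd_apply hC, integral_toReal
    (Kernel.measurable_kernel_prodMk_left hC).aemeasurable
    (.of_forall fun x ↦ measure_lt_top _ _)]

/-- If `TV(κ₁ x, κ₂ x) ≤ ε` for every `x`, then the joint laws satisfy
`TV(μ₁ ⊗ₘ κ₁, μ₂ ⊗ₘ κ₂) ≤ TV(μ₁, μ₂) + ε`. -/
theorem tvDist_compProd_le {X Y : Type*} [MeasurableSpace X] [MeasurableSpace Y]
    (μ₁ μ₂ : Measure X) [IsProbabilityMeasure μ₁] [IsProbabilityMeasure μ₂]
    (κ₁ κ₂ : Kernel X Y) [IsMarkovKernel κ₁] [IsMarkovKernel κ₂]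
    (ε : ℝ) (hε : 0 ≤ ε) (hκ : ∀ x : X, tvDist (κ₁ x) (κ₂ x) ≤ ε) :
    tvDist (μ₁ ⊗ₘ κ₁) (μ₂ ⊗ₘ κ₂) ≤ tvDist μ₁ μ₂ + ε := by
  refine ciSup_le fun ⟨C, hC⟩ ↦ ?_
  have hmeas (κ : Kernel X Y) [IsMarkovKernel κ] :
      Measurable fun x ↦ (κ x (Prod.mk x ⁻¹' C)).toReal :=
    (Kernel.measurable_kernel_prodMk_left hC).ennreal_toReal
  have hle (κ : Kernel X Y) [IsMarkovKernel κ] (x : X) :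
      (κ x (Prod.mk x ⁻¹' C)).toReal ≤ 1 := measureReal_le_one
  have hint (κ : Kernel X Y) [IsMarkovKernel κ] :
      Integrable (fun x ↦ (κ x (Prod.mk x ⁻¹' C)).toReal) μ₂ :=
    Integrable.of_bound (hmeas κ).aestronglyMeasurable 1
      (.of_forall fun x ↦ by rw [Real.norm_of_nonneg ENNReal.toReal_nonneg]; exact hle κ x)
  rw [toReal_compProd_apply μ₁ κ₁ hC, toReal_compProd_apply μ₂ κ₂ hC]
  refine (abs_sub_le _ (∫ x, (κ₁ x (Prod.mk x ⁻¹' C)).toReal ∂μ₂) _).trans (add_le_add ?_ ?_)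
  · exact abs_integral_sub_integral_le_tvDist μ₁ μ₂ (hmeas κ₁)
      (fun _ ↦ ENNReal.toReal_nonneg) (hle κ₁)
  · rw [← integral_sub (hint κ₁) (hint κ₂), ← Real.norm_eq_abs]
    refine (norm_integral_le_of_norm_le_const (.of_forall fun x ↦ ?_)).trans_eq
      (by rw [probReal_univ, mul_one])
    exact (abs_toReal_sub_le_tvDist (κ₁ x) (κ₂ x) (measurable_prodMk_left hC)).trans (hκ x)
end

section
/- Let S be a measurable space, A a nonempty set, and d ≥ 1. Let φ : S × A → ℝ^d, θ ∈ ℝ^d, and let α₁, …, α_d and β₁, …, β_d be finite measures on S. Suppose that for every (x,a) ∈ S × A, P(x,a) is a probability measure on S satisfying P(x,a)(B) = Σ_{i=1}^d φᵢ(x,a)·(αᵢ(B) − βᵢ(B)) for every measurable B ⊆ S, and that the reward is r(x,a) = ⟨φ(x,a), θ⟩. Let V : S → ℝ be bounded and measurable, and define the Bellman image T(x,a) := r(x,a) + ∫_S V dP(x,a). Then for all (x,a), T(x,a) = ⟨φ(x,a), θ + u⟩, where u ∈ ℝ^d is given by uᵢ = ∫_S V dαᵢ − ∫_S V dβᵢ.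 Consequently, if Q(x,a) = ⟨φ(x,a), w⟩ for some w ∈ ℝ^d, then the Bellman residual satisfies Q(x,a) − T(x,a) = ⟨φ(x,a), w − θ − u⟩ for all (x,a). -/
open MeasureTheory
open scoped RealInnerProductSpace

/-- If a finite measure is, on measurable sets, a real linear combination of differences of
finite measures, then so is the integral of any function integrable for all of them. -/
theorem integral_eq_sum_mul_sub_of_measureReal_eq {S ι : Type*} [MeasurableSpace S] [Fintype ι]
    {μ : Measure S} [IsFiniteMeasure μ] {α β : ι → Measure S}
    [∀ i, IsFiniteMeasure (α i)] [∀ i, IsFiniteMeasure (β i)] {c : ι → ℝ}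
    (h : ∀ B, MeasurableSet B → μ.real B = ∑ i, c i * ((α i).real B - (β i).real B))
    {V : S → ℝ} (hμ : Integrable V μ) (hα : ∀ i, Integrable V (α i))
    (hβ : ∀ i, Integrable V (β i)) :
    ∫ x, V x ∂μ = ∑ i, c i * ((∫ x, V x ∂(α i)) - ∫ x, V x ∂(β i)) := by
  obtain ⟨p, n, hc⟩ : ∃ p n : ι → NNReal, ∀ i, c i = p i - n i :=
    ⟨fun i => (c i).toNNReal, fun i => (-c i).toNNReal, fun i => by
      simp only [Real.coe_toNNReal']
      exact (max_zero_sub_max_neg_zero_eq_self (c i)).symm⟩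
  let ν₁ : ι → Measure S := fun i => p i • β i + n i • α i
  let ν₂ : ι → Measure S := fun i => p i • α i + n i • β i
  have hν₁ (i : ι) : Integrable V (ν₁ i) :=
    ((hβ i).smul_measure_nnreal).add_measure ((hα i).smul_measure_nnreal)
  have hν₂ (i : ι) : Integrable V (ν₂ i) :=
    ((hα i).smul_measure_nnreal).add_measure ((hβ i).smul_measure_nnreal)
  have key : μ + ∑ i, ν₁ i = ∑ i, ν₂ i := by
    refine Measure.ext fun B hB => ?_
    rw [← measureReal_eq_measureReal_iff]
    have hsum (ν : ι → Measure S) [∀ i, IsFiniteMeasure (ν i)] :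
        (∑ i, ν i).real B = ∑ i, (ν i).real B := by
      simp only [measureReal_def, Measure.finsetSum_apply]
      exact ENNReal.toReal_sum fun i _ => measure_ne_top _ _
    rw [measureReal_add_apply, hsum ν₁, hsum ν₂, h B hB, ← Finset.sum_add_distrib]
    refine Finset.sum_congr rfl fun i _ => ?_
    simp only [ν₁, ν₂]
    rw [measureReal_add_apply, measureReal_add_apply, hc i]
    simp only [measureReal_nnreal_smul_apply]
    ring
  have hint := congrArg (fun ν => ∫ x, V x ∂ν) key
  beta_reduce at hint
  rw [integral_add_measure hμ (integrable_finsetSum_measure.2 fun i _ => hν₁ i),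
    integral_finsetSum_measure fun i _ => hν₁ i,
    integral_finsetSum_measure fun i _ => hν₂ i] at hint
  rw [eq_sub_of_add_eq hint, ← Finset.sum_sub_distrib]
  refine Finset.sum_congr rfl fun i _ => ?_
  rw [integral_add_measure ((hα i).smul_measure_nnreal) ((hβ i).smul_measure_nnreal),
    integral_add_measure ((hβ i).smul_measure_nnreal) ((hα i).smul_measure_nnreal)]
  simp only [integral_smul_nnreal_measure, NNReal.smul_def, smul_eq_mul]
  rw [hc i]
  ring

/-- In a linear MDP, the Bellman backup of any bounded measurable value function is an
exactly linear function of the features: `T(x,a) = ⟪φ(x,a), θ + u⟫` with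
`uᵢ = ∫ V dαᵢ − ∫ V dβᵢ`; consequently the Bellman residual of a linear `Q`-function is
linear in the features. -/
theorem linear_mdp_bellman_linear {S : Type*} [MeasurableSpace S] {A : Type*} [Nonempty A]
    (d : ℕ) (hd : 1 ≤ d)
    (φ : S × A → EuclideanSpace ℝ (Fin d)) (θ : EuclideanSpace ℝ (Fin d))
    (α β : Fin d → Measure S) [∀ i, IsFiniteMeasure (α i)] [∀ i, IsFiniteMeasure (β i)]
    (P : S × A → Measure S) [∀ p : S × A, IsProbabilityMeasure (P p)]
    (hP : ∀ p : S × A, ∀ B : Set S, MeasurableSet B →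
      ((P p) B).toReal = ∑ i, φ p i * ((α i B).toReal - (β i B).toReal))
    (r : S × A → ℝ) (hr : ∀ p, r p = ⟪φ p, θ⟫)
    (V : S → ℝ) (hV : Measurable V) (M : ℝ) (hVb : ∀ x, |V x| ≤ M)
    (T : S × A → ℝ) (hT : ∀ p, T p = r p + ∫ x, V x ∂(P p))
    (u : EuclideanSpace ℝ (Fin d))
    (hu : ∀ i, u i = (∫ x, V x ∂(α i)) - ∫ x, V x ∂(β i)) :
    (∀ p, T p = ⟪φ p, θ + u⟫) ∧
      ∀ (w : EuclideanSpace ℝ (Fin d)) (Q : S × A → ℝ),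
        (∀ p, Q p = ⟪φ p, w⟫) → ∀ p, Q p - T p = ⟪φ p, w - θ - u⟫ := by
  have hint (μ : Measure S) [IsFiniteMeasure μ] : Integrable V μ :=
    Integrable.of_bound hV.aestronglyMeasurable M (.of_forall hVb)
  have hTlin (p : S × A) : T p = ⟪φ p, θ + u⟫ := by
    rw [hT, hr, inner_add_right, integral_eq_sum_mul_sub_of_measureReal_eq (hP p) (hint _)
      (fun i => hint _) fun i => hint _]
    congr 1
    simp [PiLp.inner_apply, hu, mul_comm]
  refine ⟨hTlin, fun w Q hQ p => ?_⟩
  rw [hQ, hTlin, ← inner_sub_right, sub_sub]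
end

section
/- Let S and A be measurable spaces with A nonempty, and let H ≥ 1. For each h ∈ {1, …, H}, let P_h be a Markov kernel from S × A to S, let r_h : S × A → ℝ be bounded and measurable, let Q_h : S × A → ℝ be bounded and measurable (and set Q_{H+1} := 0), and let π_h : S → A be measurable and greedy with respect to Q_h, i.e. Q_h(x, π_h(x)) = ⨆_{a ∈ A} Q_h(x, a) for every x ∈ S. Write M_h(x) := ⨆_{a ∈ A} Q_h(x, a) (so M_h(x) = Q_h(x, π_h(x)) and M_{H+1} = 0). Define the value of the policy π = (π_1, …, π_H) by the backward recursion V_{H+1} := 0 and V_h(x) := r_h(x, π_h(x)) + ∫_S V_{h+1}(y) d(P_h(x, π_h(x)))(y), and define the cumulative Bellman-residual functional by g_{H+1} := 0 and g_h(x) := Q_h(x, π_h(x)) − r_h(x, π_h(x)) − ∫_S M_{h+1}(y) d(P_h(x, π_h(x)))(y) + ∫_S g_{h+1}(y) d(P_h(x, π_h(x)))(y). Then for every x ∈ S, V_1(x) = M_1(x) − g_1(x). -/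
open MeasureTheory ProbabilityTheory

/-- Averaging a bounded measurable function over a Markov kernel along a measurable map gives a
bounded measurable function. -/
theorem measurable_bounded_integral_kernel_comp {S T X : Type*} [MeasurableSpace S]
    [MeasurableSpace T] [MeasurableSpace X] (κ : Kernel T X) [IsMarkovKernel κ] {φ : S → T}
    (hφ : Measurable φ) {f : X → ℝ} (hf : Measurable f) {C : ℝ} (hC : ∀ y, |f y| ≤ C) :
    Measurable (fun x => ∫ y, f y ∂(κ (φ x))) ∧ ∀ x, |∫ y, f y ∂(κ (φ x))| ≤ C := by
  refine ⟨(hf.stronglyMeasurable.integral_kernel (κ := κ)).measurable.comp hφ, fun x => ?_⟩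
  simpa using norm_integral_le_of_norm_le_const (μ := κ (φ x)) (f := f)
    (Filter.Eventually.of_forall hC)

/-- Regret decomposition: the true value `V₁` of the greedy policy `π` with respect to the
`Q`-estimates equals the estimated optimal value `M₁(x) = ⨆_a Q₁(x,a)` minus the expected
cumulative Bellman residual `g₁(x)` along the trajectory of `π`. -/
theorem regret_decomposition {S A : Type*} [MeasurableSpace S] [MeasurableSpace A] [Nonempty A]
    (H : ℕ) (hH : 1 ≤ H)
    (P : ℕ → Kernel (S × A) S) [∀ h, IsMarkovKernel (P h)]
    (r Q : ℕ → S × A → ℝ)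
    (hrm : ∀ h, Measurable (r h)) (hQm : ∀ h, Measurable (Q h))
    (Cr CQ : ℝ) (hrb : ∀ h p, |r h p| ≤ Cr) (hQb : ∀ h p, |Q h p| ≤ CQ)
    (hQtop : ∀ p, Q (H + 1) p = 0)
    (π : ℕ → S → A) (hπm : ∀ h, Measurable (π h))
    (hgreedy : ∀ h ∈ Finset.Icc 1 H, ∀ x : S, Q h (x, π h x) = ⨆ a : A, Q h (x, a))
    (M : ℕ → S → ℝ) (hM : ∀ h, ∀ x : S, M h x = ⨆ a : A, Q h (x, a))
    (V g : ℕ → S → ℝ)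
    (hVtop : ∀ x, V (H + 1) x = 0) (hgtop : ∀ x, g (H + 1) x = 0)
    (hV : ∀ h ∈ Finset.Icc 1 H, ∀ x : S,
      V h x = r h (x, π h x) + ∫ y, V (h + 1) y ∂((P h) (x, π h x)))
    (hg : ∀ h ∈ Finset.Icc 1 H, ∀ x : S,
      g h x = Q h (x, π h x) - r h (x, π h x)
        - (∫ y, M (h + 1) y ∂((P h) (x, π h x)))
        + ∫ y, g (h + 1) y ∂((P h) (x, π h x))) :
    ∀ x : S, V 1 x = M 1 x - g 1 x := by
  have integrable_of_bounded : ∀ (f : S → ℝ) (C : ℝ), Measurable f → (∀ y, |f y| ≤ C) →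
      ∀ (μ : Measure S) [IsProbabilityMeasure μ], Integrable f μ := fun f C hf hC μ _ =>
    .of_bound hf.aestronglyMeasurable C (.of_forall hC)
  have hMQ : ∀ h ∈ Finset.Icc 1 H, ∀ x, M h x = Q h (x, π h x) := fun h hh x =>
    (hM h x).trans (hgreedy h hh x).symm
  have hMtop : ∀ x, M (H + 1) x = 0 := fun x => by simp [hM, hQtop]
  have hMbound : ∀ h, 1 ≤ h → h ≤ H + 1 → Measurable (M h) ∧ ∃ C, ∀ x, |M h x| ≤ C := by
    intro h h1 h2
    rcases h2.eq_or_lt with rfl | h2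
    · exact ⟨by simpa only [funext hMtop] using measurable_const, 0, by simp [hMtop]⟩
    · have hh : h ∈ Finset.Icc 1 H := Finset.mem_Icc.2 ⟨h1, by omega⟩
      rw [funext (hMQ h hh)]
      exact ⟨(hQm h).comp (measurable_id.prodMk (hπm h)), CQ, fun x => hQb _ _⟩
  have key : ∀ h, h ≤ H + 1 → 1 ≤ h →
      Measurable (V h) ∧ (∃ C, ∀ x, |V h x| ≤ C) ∧ ∀ x, g h x = M h x - V h x := by
    intro h hle
    induction hle using Nat.decreasingInduction with
    | self =>
      intro _
      exact ⟨by simpa only [funext hVtop] using measurable_const, ⟨0, by simp [hVtop]⟩,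
        by simp [hVtop, hgtop, hMtop]⟩
    | of_succ h hlt ih =>
      intro h1
      have hh : h ∈ Finset.Icc 1 H := Finset.mem_Icc.2 ⟨h1, by omega⟩
      obtain ⟨hVm, ⟨C, hC⟩, hgV⟩ := ih (by omega)
      obtain ⟨hMm, D, hD⟩ := hMbound (h + 1) (by omega) (by omega)
      have hφ : Measurable fun x => (x, π h x) := measurable_id.prodMk (hπm h)
      obtain ⟨hIm, hIb⟩ := measurable_bounded_integral_kernel_comp (P h) hφ hVm hC
      refine ⟨?_, ⟨Cr + C, fun x => ?_⟩, fun x => ?_⟩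
      · rw [funext (hV h hh)]
        exact ((hrm h).comp hφ).add hIm
      · rw [hV h hh]
        exact (abs_add_le _ _).trans (add_le_add (hrb _ _) (hIb x))
      · rw [hg h hh, hV h hh, hMQ h hh, funext hgV,
          integral_sub (integrable_of_bounded _ D hMm hD _) (integrable_of_bounded _ C hVm hC _)]
        ring
  intro x
  rw [(key 1 (by omega) le_rfl).2.2 x]
  ring
end

section
/- Let S be a measurable space, A a nonempty set, d ≥ 1 and H ≥ 1. For each h ∈ {1, …, H}, let θ_h ∈ ℝ^d, let α₁^h, …, α_d^h and β₁^h, …, β_d^h be finite measures on S, and let φ : S × A → ℝ^d. Assume: (i) for every (x,a), P_h(x,a) is a probability measure on S with P_h(x,a)(B) = Σ_{i=1}^d φᵢ(x,a)·(αᵢ^h(B) − βᵢ^h(B)) for all measurable B; (ii) the rewards r_h(x,a) := ⟨φ(x,a), θ_h⟩ satisfy 0 ≤ r_h(x,a) ≤ 1 for all (x,a); (iii) ‖φ(x,a)‖₂ ≤ 1 for all (x,a); (iv) ‖θ_h‖₂ ≤ √d; and (v) the vector (αᵢ^h(S) + βᵢ^h(S))_{i=1}^d has Euclidean norm at most √d.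 Define the optimal Q-functions by backward induction: Q*_{H+1} := 0 and Q*_h(x,a) := r_h(x,a) + ∫_S V*_{h+1} dP_h(x,a), where V*_{h+1}(x) := ⨆_{a ∈ A} Q*_{h+1}(x, a), and assume each V*_{h+1} is measurable. Then for each h ∈ {1, …, H} there exists w_h ∈ ℝ^d with ‖w_h‖₂ ≤ (H − h + 1)·√d such that Q*_h(x,a) = ⟨φ(x,a), w_h⟩ for all (x,a) ∈ S × A. -/
open MeasureTheory
open scoped RealInnerProductSpace

/-- Integration of a bounded measurable function is linear in a finite signed combination
`∑ i, c i • (α i - β i)` of finite measures. -/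
lemma integral_eq_sum_of_toReal_eq_sum {S ι : Type*} [MeasurableSpace S] [Fintype ι]
    (α β : ι → Measure S) [∀ i, IsFiniteMeasure (α i)] [∀ i, IsFiniteMeasure (β i)]
    (P : Measure S) [IsFiniteMeasure P] (c : ι → ℝ)
    (hP : ∀ B : Set S, MeasurableSet B →
      (P B).toReal = ∑ i, c i * ((α i B).toReal - (β i B).toReal))
    {f : S → ℝ} (hf : Measurable f) {M : ℝ} (hM : ∀ x, ‖f x‖ ≤ M) :
    ∫ x, f x ∂P = ∑ i, c i * (∫ x, f x ∂(α i) - ∫ x, f x ∂(β i)) := by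
  have hint (ν : Measure S) [IsFiniteMeasure ν] : Integrable f ν :=
    .of_bound hf.aestronglyMeasurable M (.of_forall hM)
  set p : ι → NNReal := fun i ↦ (c i).toNNReal with hp
  set q : ι → NNReal := fun i ↦ (-c i).toNNReal with hq
  have hpq i : c i = p i - q i := by
    simp only [hp, hq, Real.coe_toNNReal']
    exact (max_zero_sub_max_neg_zero_eq_self (c i)).symm
  have key : P + ∑ i, (q i • α i + p i • β i) = ∑ i, (p i • α i + q i • β i) := by
    ext B hB
    rw [← ENNReal.toReal_eq_toReal_iff' (measure_ne_top _ _) (measure_ne_top _ _)]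
    change Measure.real _ B = Measure.real _ B
    have hB' := hP B hB
    change P.real B = ∑ i, c i * ((α i).real B - (β i).real B) at hB'
    have hsum (ν : ι → Measure S) [∀ i, IsFiniteMeasure (ν i)] :
        (∑ i, ν i).real B = ∑ i, (ν i).real B := by
      simp only [measureReal_def, Measure.coe_finsetSum, Finset.sum_apply]
      exact ENNReal.toReal_sum fun i _ ↦ measure_ne_top _ _
    rw [measureReal_add_apply, hsum, hsum, hB', ← Finset.sum_add_distrib]
    refine Finset.sum_congr rfl fun i _ ↦ ?_
    rw [measureReal_add_apply, measureReal_add_apply, hpq]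
    simp only [measureReal_nnreal_smul_apply]
    ring
  have hI := congrArg (fun ν : Measure S ↦ ∫ x, f x ∂ν) key
  rw [integral_add_measure (hint _) (hint _), integral_finsetSum_measure fun i _ ↦ hint _,
    integral_finsetSum_measure fun i _ ↦ hint _] at hI
  rw [← eq_sub_iff_add_eq, ← Finset.sum_sub_distrib] at hI
  rw [hI]
  refine Finset.sum_congr rfl fun i _ ↦ ?_
  rw [integral_add_measure (hint _) (hint _), integral_add_measure (hint _) (hint _),
    integral_smul_nnreal_measure, integral_smul_nnreal_measure, integral_smul_nnreal_measure,
    integral_smul_nnreal_measure, hpq]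
  simp only [NNReal.smul_def, smul_eq_mul]
  ring

/-- The Euclidean norm of the vector of integrals of `f` against `α i - β i` is at most
`sup |f|` times the norm of the vector of masses `α i univ + β i univ`. -/
lemma norm_toLp_integral_sub_le {S ι : Type*} [MeasurableSpace S] [Fintype ι]
    (α β : ι → Measure S) [∀ i, IsFiniteMeasure (α i)] [∀ i, IsFiniteMeasure (β i)]
    {f : S → ℝ} {M : ℝ} (hM0 : 0 ≤ M) (hM : ∀ x, ‖f x‖ ≤ M) :
    ‖WithLp.toLp 2 fun i ↦ ∫ x, f x ∂(α i) - ∫ x, f x ∂(β i)‖ ≤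
      M * Real.sqrt (∑ i, ((α i Set.univ).toReal + (β i Set.univ).toReal) ^ 2) := by
  rw [EuclideanSpace.norm_eq, ← Real.sqrt_sq hM0, ← Real.sqrt_mul (sq_nonneg M), Finset.mul_sum]
  refine Real.sqrt_le_sqrt (Finset.sum_le_sum fun i _ ↦ ?_)
  rw [← mul_pow]
  refine pow_le_pow_left₀ (norm_nonneg _) ?_ 2
  calc ‖∫ x, f x ∂(α i) - ∫ x, f x ∂(β i)‖
      ≤ ‖∫ x, f x ∂(α i)‖ + ‖∫ x, f x ∂(β i)‖ := norm_sub_le _ _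
    _ ≤ M * (α i).real Set.univ + M * (β i).real Set.univ :=
        add_le_add (norm_integral_le_of_norm_le_const (.of_forall hM))
          (norm_integral_le_of_norm_le_const (.of_forall hM))
    _ = M * ((α i Set.univ).toReal + (β i Set.univ).toReal) := (mul_add ..).symm

/-- Realizability in linear MDPs: under the linear MDP structure with the standard
normalizations, the optimal `Q`-function at every stage `h ∈ {1, …, H}` is a linear function
of the features, `Q*_h(x,a) = ⟪φ(x,a), w_h⟫`, with `‖w_h‖₂ ≤ (H − h + 1)·√d`. -/
theorem linear_mdp_realizability {S : Type*} [MeasurableSpace S] {A : Type*} [Nonempty A]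
    (d H : ℕ) (hd : 1 ≤ d) (hH : 1 ≤ H)
    (φ : S × A → EuclideanSpace ℝ (Fin d))
    (θ : ℕ → EuclideanSpace ℝ (Fin d))
    (α β : ℕ → Fin d → Measure S)
    [∀ h i, IsFiniteMeasure (α h i)] [∀ h i, IsFiniteMeasure (β h i)]
    (P : ℕ → S × A → Measure S) [∀ h, ∀ p : S × A, IsProbabilityMeasure (P h p)]
    (hP : ∀ h ∈ Finset.Icc 1 H, ∀ p : S × A, ∀ B : Set S, MeasurableSet B →
      ((P h p) B).toReal = ∑ i, φ p i * ((α h i B).toReal - (β h i B).toReal))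
    (r : ℕ → S × A → ℝ) (hr : ∀ h ∈ Finset.Icc 1 H, ∀ p, r h p = ⟪φ p, θ h⟫)
    (hr01 : ∀ h ∈ Finset.Icc 1 H, ∀ p, 0 ≤ r h p ∧ r h p ≤ 1)
    (hφ : ∀ p, ‖φ p‖ ≤ 1)
    (hθ : ∀ h ∈ Finset.Icc 1 H, ‖θ h‖ ≤ Real.sqrt d)
    (hμ : ∀ h ∈ Finset.Icc 1 H,
      Real.sqrt (∑ i, ((α h i Set.univ).toReal + (β h i Set.univ).toReal) ^ 2)
        ≤ Real.sqrt d)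
    (Qs : ℕ → S × A → ℝ) (Vs : ℕ → S → ℝ)
    (hQtop : ∀ p, Qs (H + 1) p = 0)
    (hVs : ∀ h, ∀ x : S, Vs h x = ⨆ a : A, Qs h (x, a))
    (hVmeas : ∀ h, Measurable (Vs h))
    (hQs : ∀ h ∈ Finset.Icc 1 H, ∀ p, Qs h p = r h p + ∫ x, Vs (h + 1) x ∂(P h p)) :
    ∀ h ∈ Finset.Icc 1 H, ∃ w : EuclideanSpace ℝ (Fin d),
      ‖w‖ ≤ ((H : ℝ) - h + 1) * Real.sqrt d ∧ ∀ p, Qs h p = ⟪φ p, w⟫ := by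
  have bound : ∀ k h, 1 ≤ h → h + k = H + 1 → ∀ p, 0 ≤ Qs h p ∧ Qs h p ≤ k := by
    have hV {h : ℕ} {M : ℝ} (hQ : ∀ p, 0 ≤ Qs h p ∧ Qs h p ≤ M) (x : S) :
        0 ≤ Vs h x ∧ Vs h x ≤ M := by
      rw [hVs]
      exact ⟨Real.iSup_nonneg fun a ↦ (hQ _).1, ciSup_le fun a ↦ (hQ _).2⟩
    intro k
    induction k with
    | zero =>
      rintro h - rfl p
      simp [hQtop]
    | succ k ih =>
      intro h h1 hk p
      have hmem : h ∈ Finset.Icc 1 H := Finset.mem_Icc.2 ⟨h1, by omega⟩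
      have hVb := hV (ih (h + 1) (by omega) (by omega))
      have hle : ∫ x, Vs (h + 1) x ∂(P h p) ≤ k := by
        refine (Real.le_norm_self _).trans ?_
        simpa using norm_integral_le_of_norm_le_const (μ := P h p) (.of_forall fun x ↦
          (Real.norm_of_nonneg (hVb x).1).trans_le (hVb x).2)
      have hnonneg : 0 ≤ ∫ x, Vs (h + 1) x ∂(P h p) := integral_nonneg fun x ↦ (hVb x).1
      have := hr01 h hmem p
      rw [hQs h hmem]
      push_cast
      constructor <;> linarith
  intro h hmem
  obtain ⟨h1, hH'⟩ := Finset.mem_Icc.1 hmem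
  have hQ := bound (H - h) (h + 1) (by omega) (by omega)
  rw [Nat.cast_sub hH'] at hQ
  have hM0 : (0 : ℝ) ≤ (H : ℝ) - h := sub_nonneg.2 (by exact_mod_cast hH')
  have hVb (x : S) : ‖Vs (h + 1) x‖ ≤ (H : ℝ) - h := by
    rw [hVs, Real.norm_of_nonneg (Real.iSup_nonneg fun a ↦ (hQ _).1)]
    exact ciSup_le fun a ↦ (hQ _).2
  refine ⟨θ h + WithLp.toLp 2 fun i ↦
    ∫ x, Vs (h + 1) x ∂(α h i) - ∫ x, Vs (h + 1) x ∂(β h i), ?_, fun p ↦ ?_⟩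
  · refine (norm_add_le _ _).trans ?_
    have := (norm_toLp_integral_sub_le (α h) (β h) hM0 hVb).trans
      (mul_le_mul_of_nonneg_left (hμ h hmem) hM0)
    linarith [hθ h hmem]
  · rw [hQs h hmem, hr h hmem, inner_add_right,
      integral_eq_sum_of_toReal_eq_sum (α h) (β h) (P h p) (φ p) (hP h hmem p) (hVmeas _) hVb]
    simp [PiLp.inner_apply, mul_comm]
end
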